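/- arXiv:1610.00207 — 3 statements merged into one kernel-verified Lean document; each statement's English description precedes it below -/
import Mathlib

section
/- (Lemma A1, ℓ2-bound for the primal subvector) Under Assumption 1, if λ ≤ c_min²/(10·c_b·s·c_max) and ‖Xᵀε/n‖_∞ ≤ λ/4, then the restricted estimator satisfies ‖α̂_S − β*_S‖₂ ≤ 5·λ·√s / c_min. -/
open scoped BigOperators
open Matrix

noncomputable section

/-- Logistic function `ρ(u,v) = exp(uᵀv)/(1+exp(uᵀv))`. -/
def rho {ι : Type*} [Fintype ι] (u v : ι → ℝ) : ℝ :=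
  Real.exp (u ⬝ᵥ v) / (1 + Real.exp (u ⬝ᵥ v))

/-- `w(u,v) = exp(uᵀv)/(1+exp(uᵀv))²`. -/
def wFun {ι : Type*} [Fintype ι] (u v : ι → ℝ) : ℝ :=
  Real.exp (u ⬝ᵥ v) / (1 + Real.exp (u ⬝ᵥ v)) ^ 2

/-- The ℓ1-norm of a vector. -/
def l1norm {ι : Type*} [Fintype ι] (v : ι → ℝ) : ℝ := ∑ j, |v j|

/-- The ℓ2-norm of a vector. -/
def l2norm {ι : Type*} [Fintype ι] (v : ι → ℝ) : ℝ := Real.sqrt (∑ j, (v j) ^ 2)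

/-- The ℓ∞-norm of a vector. -/
def linfNorm {ι : Type*} [Fintype ι] (v : ι → ℝ) : ℝ := ⨆ j, |v j|

/-- The ℓ∞-to-ℓ∞ operator norm of a matrix: the maximum absolute row sum. -/
def opInf {ι κ : Type*} [Fintype ι] [Fintype κ] (M : Matrix ι κ ℝ) : ℝ :=
  ⨆ i, ∑ j, |M i j|

/-- The spectral norm (ℓ2-to-ℓ2 operator norm) of a matrix. -/
def op2 {ι κ : Type*} [Fintype ι] [Fintype κ] (M : Matrix ι κ ℝ) : ℝ :=
  sSup {c : ℝ | ∃ v : κ → ℝ, l2norm v = 1 ∧ c = l2norm (M *ᵥ v)}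

/-- The smallest eigenvalue of a symmetric matrix, as the infimum of its
Rayleigh quotient over unit vectors. -/
def eigMin {ι : Type*} [Fintype ι] (M : Matrix ι ι ℝ) : ℝ :=
  sInf {c : ℝ | ∃ v : ι → ℝ, l2norm v = 1 ∧ c = v ⬝ᵥ (M *ᵥ v)}

/-- The largest eigenvalue of a symmetric matrix, as the supremum of its
Rayleigh quotient over unit vectors. -/
def eigMax {ι : Type*} [Fintype ι] (M : Matrix ι ι ℝ) : ℝ :=
  sSup {c : ℝ | ∃ v : ι → ℝ, l2norm v = 1 ∧ c = v ⬝ᵥ (M *ᵥ v)}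

/-- The negative log-likelihood of the logistic regression model,
`L(β) = (1/n)·Σᵢ [log(1+exp(xᵢᵀβ)) − yᵢ·xᵢᵀβ]`. -/
def logLoss {n : ℕ} {ι : Type*} [Fintype ι] (X : Matrix (Fin n) ι ℝ)
    (y : Fin n → ℝ) (β : ι → ℝ) : ℝ :=
  (1 / (n : ℝ)) * ∑ i, (Real.log (1 + Real.exp (X i ⬝ᵥ β)) - y i * (X i ⬝ᵥ β))

/-! ### The softplus function -/

/-- A function on the half-line that vanishes at `0` and has nonnegative derivative is
nonnegative. -/
lemma nonneg_of_hasDerivAt_nonneg {g g' : ℝ → ℝ} (hg : ∀ x, HasDerivAt g (g' x) x)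
    (h0 : g 0 = 0) (hg' : ∀ x, 0 ≤ x → 0 ≤ g' x) {x : ℝ} (hx : 0 ≤ x) : 0 ≤ g x := by
  have hmono : MonotoneOn g (Set.Ici 0) := by
    refine monotoneOn_of_deriv_nonneg (convex_Ici 0)
      (fun z _ => (hg z).continuousAt.continuousWithinAt)
      (fun z _ => (hg z).differentiableAt.differentiableWithinAt) fun z hz => ?_
    rw [interior_Ici] at hz
    rw [(hg z).deriv]
    exact hg' z (le_of_lt hz)
  simpa [h0] using hmono Set.self_mem_Ici hx hx

/-- The derivative of the softplus function is the logistic function. -/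
lemma hasDerivAt_softplus (t : ℝ) :
    HasDerivAt (fun t => Real.log (1 + Real.exp t)) (Real.exp t / (1 + Real.exp t)) t :=
  ((Real.hasDerivAt_exp t).const_add 1).log (by positivity)

/-- The derivative of the logistic function. -/
lemma hasDerivAt_logistic (t : ℝ) :
    HasDerivAt (fun t => Real.exp t / (1 + Real.exp t))
      (Real.exp t / (1 + Real.exp t) ^ 2) t := by
  have h := (Real.hasDerivAt_exp t).fun_div ((Real.hasDerivAt_exp t).const_add 1)
    (by positivity)
  refine h.congr_deriv ?_
  ring

/-- The second derivative of the logistic function. -/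
lemma hasDerivAt_logistic_weight (t : ℝ) :
    HasDerivAt (fun t => Real.exp t / (1 + Real.exp t) ^ 2)
      (Real.exp t * (1 - Real.exp t) / (1 + Real.exp t) ^ 3) t := by
  have h := (Real.hasDerivAt_exp t).fun_div (((Real.hasDerivAt_exp t).const_add 1).fun_pow 2)
    (by positivity)
  refine h.congr_deriv ?_
  have : 1 + Real.exp t ≠ 0 := by positivity
  field_simp
  push_cast
  ring

lemma convexOn_softplus : ConvexOn ℝ Set.univ fun t : ℝ => Real.log (1 + Real.exp t) := by
  refine Monotone.convexOn_univ_of_deriv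
    (fun t => (hasDerivAt_softplus t).differentiableAt) ?_
  rw [funext fun t => (hasDerivAt_softplus t).deriv]
  refine monotone_of_deriv_nonneg (fun t => (hasDerivAt_logistic t).differentiableAt)
    fun t => ?_
  rw [(hasDerivAt_logistic t).deriv]
  positivity

/-- The second derivative of the logistic function is at least `-1`. -/
lemma neg_one_le_logistic_deriv2 (t : ℝ) :
    -1 ≤ Real.exp t * (1 - Real.exp t) / (1 + Real.exp t) ^ 3 := by
  have h := Real.exp_pos t
  rw [le_div_iff₀ (by positivity)]
  nlinarith [pow_pos h 2, pow_pos h 3]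

lemma softplus_taylor_lower_of_nonneg (a : ℝ) {d : ℝ} (hd : 0 ≤ d) :
    Real.exp a / (1 + Real.exp a) * d + Real.exp a / (1 + Real.exp a) ^ 2 * (d ^ 2 / 2)
      - d ^ 3 / 6 ≤ Real.log (1 + Real.exp (a + d)) - Real.log (1 + Real.exp a) := by
  set σ := Real.exp a / (1 + Real.exp a) with hσ
  set w := Real.exp a / (1 + Real.exp a) ^ 2 with hw
  have hweight : ∀ x, 0 ≤ x →
      0 ≤ Real.exp (a + x) / (1 + Real.exp (a + x)) ^ 2 - w + x := fun x hx =>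
    nonneg_of_hasDerivAt_nonneg
      (g := fun x => Real.exp (a + x) / (1 + Real.exp (a + x)) ^ 2 - w + x)
      (fun x => (((hasDerivAt_logistic_weight (a + x)).comp_const_add a x).sub_const w).add
        (hasDerivAt_id x))
      (by simp [hw]) (fun x _ => by linarith [neg_one_le_logistic_deriv2 (a + x)]) hx
  have hlogistic : ∀ x, 0 ≤ x →
      0 ≤ Real.exp (a + x) / (1 + Real.exp (a + x)) - σ - w * x + x ^ 2 / 2 := fun x hx =>
    nonneg_of_hasDerivAt_nonneg
      (g := fun x => Real.exp (a + x) / (1 + Real.exp (a + x)) - σ - w * x + x ^ 2 / 2)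
      (fun x => ((((hasDerivAt_logistic (a + x)).comp_const_add a x).sub_const σ).sub
        ((hasDerivAt_id x).const_mul w)).add ((hasDerivAt_pow 2 x).div_const 2))
      (by simp [hσ]) (fun x hx => by simpa using hweight x hx) hx
  have := nonneg_of_hasDerivAt_nonneg
      (g := fun x => Real.log (1 + Real.exp (a + x)) - Real.log (1 + Real.exp a) - σ * x
        - w * (x ^ 2 / 2) + x ^ 3 / 6)
      (fun x => (((((hasDerivAt_softplus (a + x)).comp_const_add a x).sub_const
        (Real.log (1 + Real.exp a))).sub ((hasDerivAt_id x).const_mul σ)).sub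
        (((hasDerivAt_pow 2 x).div_const 2).const_mul w)).add
        ((hasDerivAt_pow 3 x).div_const 6))
      (by simp) (fun x hx => by
        have h := hlogistic x hx
        norm_num
        linarith) hd
  linarith

lemma softplus_neg (t : ℝ) :
    Real.log (1 + Real.exp (-t)) = Real.log (1 + Real.exp t) - t := by
  have h : 1 + Real.exp (-t) = (1 + Real.exp t) / Real.exp t := by
    rw [Real.exp_neg]
    field_simp
    ring
  rw [h, Real.log_div (by positivity) (by positivity), Real.log_exp]

/-- Second-order Taylor lower bound for the softplus function with cubic remainder. -/
lemma softplus_taylor_lower (a d : ℝ) :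
    Real.exp a / (1 + Real.exp a) * d + Real.exp a / (1 + Real.exp a) ^ 2 * (d ^ 2 / 2)
      - |d| ^ 3 / 6 ≤ Real.log (1 + Real.exp (a + d)) - Real.log (1 + Real.exp a) := by
  rcases le_total 0 d with hd | hd
  · rw [abs_of_nonneg hd]
    exact softplus_taylor_lower_of_nonneg a hd
  · rw [abs_of_nonpos hd]
    have h := softplus_taylor_lower_of_nonneg (-a) (neg_nonneg.2 hd)
    rw [← neg_add, softplus_neg, softplus_neg] at h
    have hσ : Real.exp (-a) / (1 + Real.exp (-a)) = 1 - Real.exp a / (1 + Real.exp a) := by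
      rw [Real.exp_neg]
      field_simp
      ring
    have hw : Real.exp (-a) / (1 + Real.exp (-a)) ^ 2
        = Real.exp a / (1 + Real.exp a) ^ 2 := by
      rw [Real.exp_neg]
      field_simp
      ring
    rw [hσ, hw] at h
    linarith [neg_sq d]

/-! ### Norms and Rayleigh quotients -/

section Norms

variable {ι : Type*} [Fintype ι]

lemma l2norm_smul {c : ℝ} (hc : 0 ≤ c) (v : ι → ℝ) : l2norm (c • v) = c * l2norm v := by
  simp only [l2norm, Pi.smul_apply, smul_eq_mul, mul_pow, ← Finset.mul_sum]
  rw [Real.sqrt_mul (sq_nonneg c), Real.sqrt_sq hc]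

lemma l1norm_le_sqrt_card_mul_l2norm (v : ι → ℝ) :
    l1norm v ≤ Real.sqrt (Fintype.card ι) * l2norm v := by
  have h := sq_sum_le_card_mul_sum_sq (s := Finset.univ) (f := fun j => |v j|)
  simp only [sq_abs] at h
  rw [l2norm, ← Real.sqrt_mul (Nat.cast_nonneg _)]
  exact Real.le_sqrt_of_sq_le h

lemma abs_dotProduct_le_mul_l1norm {u v : ι → ℝ} {c : ℝ} (hu : ∀ j, |u j| ≤ c) :
    |u ⬝ᵥ v| ≤ c * l1norm v := by
  rw [dotProduct, l1norm, Finset.mul_sum]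
  refine (Finset.abs_sum_le_sum_abs _ _).trans (Finset.sum_le_sum fun j _ => ?_)
  rw [abs_mul]
  exact mul_le_mul_of_nonneg_right (hu j) (abs_nonneg _)

/-- The quadratic form at `v` is `‖v‖₂²` times a Rayleigh quotient over unit vectors. -/
lemma exists_unit_quadratic_form (M : Matrix ι ι ℝ) {v : ι → ℝ} (hv : 0 < l2norm v) :
    ∃ u : ι → ℝ, l2norm u = 1 ∧ v ⬝ᵥ (M *ᵥ v) = (u ⬝ᵥ (M *ᵥ u)) * l2norm v ^ 2 := by
  refine ⟨(l2norm v)⁻¹ • v, ?_, ?_⟩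
  · rw [l2norm_smul (inv_nonneg.2 hv.le), inv_mul_cancel₀ hv.ne']
  · rw [mulVec_smul, smul_dotProduct, dotProduct_smul, smul_eq_mul, smul_eq_mul]
    field_simp

lemma eigMin_mul_sq_le {M : Matrix ι ι ℝ} (hM : 0 < eigMin M) {v : ι → ℝ}
    (hv : 0 < l2norm v) : eigMin M * l2norm v ^ 2 ≤ v ⬝ᵥ (M *ᵥ v) := by
  obtain ⟨u, hu, h⟩ := exists_unit_quadratic_form M hv
  rw [h]
  refine mul_le_mul_of_nonneg_right (csInf_le ?_ ⟨u, hu, rfl⟩) (sq_nonneg _)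
  by_contra hb
  exact hM.ne' (Real.sInf_of_not_bddBelow hb)

lemma le_eigMax_mul_sq {M : Matrix ι ι ℝ} (hM : 0 < eigMax M) {v : ι → ℝ}
    (hv : 0 < l2norm v) : v ⬝ᵥ (M *ᵥ v) ≤ eigMax M * l2norm v ^ 2 := by
  obtain ⟨u, hu, h⟩ := exists_unit_quadratic_form M hv
  rw [h]
  refine mul_le_mul_of_nonneg_right (le_csSup ?_ ⟨u, hu, rfl⟩) (sq_nonneg _)
  by_contra hb
  exact hM.ne' (Real.sSup_of_not_bddAbove hb)

lemma abs_le_linfNorm (v : ι → ℝ) (j : ι) : |v j| ≤ linfNorm v :=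
  le_ciSup (f := fun j => |v j|) (Set.finite_range _).bddAbove j

/-- The quadratic form of a weighted Gram matrix. -/
lemma quadratic_form_weighted_gram {n : ℕ} (c : ℝ) (A : Matrix (Fin n) ι ℝ)
    (w : Fin n → ℝ) (v : ι → ℝ) :
    v ⬝ᵥ ((c • (Aᵀ * Matrix.diagonal w * A)) *ᵥ v) = c * ∑ i, w i * (A i ⬝ᵥ v) ^ 2 := by
  rw [smul_mulVec, dotProduct_smul, smul_eq_mul, ← mulVec_mulVec, ← mulVec_mulVec,
    dotProduct_mulVec, vecMul_transpose]
  congr 1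
  simp only [dotProduct, mulVec_diagonal]
  refine Finset.sum_congr rfl fun i _ => ?_
  simp only [mulVec, dotProduct]
  ring

/-- The quadratic form of a Gram matrix. -/
lemma quadratic_form_gram {n : ℕ} (c : ℝ) (A : Matrix (Fin n) ι ℝ) (v : ι → ℝ) :
    v ⬝ᵥ ((c • (Aᵀ * A)) *ᵥ v) = c * ∑ i, (A i ⬝ᵥ v) ^ 2 := by
  simpa using quadratic_form_weighted_gram c A (fun _ => 1) v

lemma convexOn_logLoss {n : ℕ} (A : Matrix (Fin n) ι ℝ) (y : Fin n → ℝ) :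
    ConvexOn ℝ Set.univ (logLoss A y) := by
  refine ⟨convex_univ, fun a _ b _ μ ν hμ hν hμν => ?_⟩
  simp only [logLoss, smul_eq_mul]
  rw [mul_left_comm μ, mul_left_comm ν, ← mul_add, Finset.mul_sum _ _ μ, Finset.mul_sum _ _ ν,
    ← Finset.sum_add_distrib]
  refine mul_le_mul_of_nonneg_left (Finset.sum_le_sum fun i _ => ?_) (by positivity)
  have h := convexOn_softplus.2 (Set.mem_univ (A i ⬝ᵥ a)) (Set.mem_univ (A i ⬝ᵥ b)) hμ hν hμν
  simp only [smul_eq_mul] at h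
  rw [dotProduct_add, dotProduct_smul, dotProduct_smul, smul_eq_mul, smul_eq_mul]
  linarith

lemma convexOn_l1norm : ConvexOn ℝ Set.univ (l1norm : (ι → ℝ) → ℝ) := by
  refine ⟨convex_univ, fun a _ b _ μ ν hμ hν _ => ?_⟩
  simp only [l1norm, smul_eq_mul, Pi.add_apply, Pi.smul_apply]
  rw [Finset.mul_sum, Finset.mul_sum, ← Finset.sum_add_distrib]
  refine Finset.sum_le_sum fun j _ => (abs_add_le _ _).trans_eq ?_
  rw [abs_mul, abs_mul, abs_of_nonneg hμ, abs_of_nonneg hν]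

lemma l1norm_sub_le (a v : ι → ℝ) : l1norm a - l1norm (a + v) ≤ l1norm v := by
  simp only [l1norm, ← Finset.sum_sub_distrib]
  refine Finset.sum_le_sum fun j _ => ?_
  have h := abs_sub_abs_le_abs_sub (a j) ((a + v) j)
  rwa [Pi.add_apply, sub_add_cancel_left, abs_neg] at h

/-- Lower bound on the increment of the logistic loss: gradient, Hessian, cubic remainder. -/
lemma logLoss_taylor_lower {n : ℕ} (A : Matrix (Fin n) ι ℝ) (y : Fin n → ℝ) (b v : ι → ℝ)
    {D : ℝ} (hD : ∀ i, |A i ⬝ᵥ v| ≤ D) :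
    -((1 / (n : ℝ)) * ∑ i, (y i - rho (A i) b) * (A i ⬝ᵥ v))
      + (1 / (n : ℝ) * ∑ i, wFun (A i) b * (A i ⬝ᵥ v) ^ 2) / 2
      - D / 6 * (1 / (n : ℝ) * ∑ i, (A i ⬝ᵥ v) ^ 2)
      ≤ logLoss A y (b + v) - logLoss A y b := by
  have hsum : ∑ i, (-((y i - rho (A i) b) * (A i ⬝ᵥ v))
      + wFun (A i) b * (A i ⬝ᵥ v) ^ 2 / 2 - D / 6 * (A i ⬝ᵥ v) ^ 2)
      ≤ ∑ i, ((Real.log (1 + Real.exp (A i ⬝ᵥ (b + v))) - y i * (A i ⬝ᵥ (b + v)))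
        - (Real.log (1 + Real.exp (A i ⬝ᵥ b)) - y i * (A i ⬝ᵥ b))) := by
    refine Finset.sum_le_sum fun i _ => ?_
    have h := softplus_taylor_lower (A i ⬝ᵥ b) (A i ⬝ᵥ v)
    have h3 : |A i ⬝ᵥ v| ^ 3 ≤ D * (A i ⬝ᵥ v) ^ 2 := by
      rw [← sq_abs (A i ⬝ᵥ v), pow_succ' _ 2]
      exact mul_le_mul_of_nonneg_right (hD i) (sq_nonneg _)
    rw [dotProduct_add]
    simp only [rho, wFun]
    linarith
  have h := mul_le_mul_of_nonneg_left hsum (by positivity : 0 ≤ 1 / (n : ℝ))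
  rw [Finset.sum_sub_distrib, Finset.sum_add_distrib, Finset.sum_neg_distrib,
    ← Finset.mul_sum, ← Finset.sum_div, Finset.sum_sub_distrib] at h
  simp only [logLoss]
  linarith

end Norms

/-- Extension by zero of a vector indexed by `S` preserves sums weighted by its values. -/
lemma sum_extend_zero {p : ℕ} (S : Finset (Fin p)) (v : {j // j ∈ S} → ℝ)
    (g : Fin p → ℝ → ℝ) (hg : ∀ j, g j 0 = 0) :
    ∑ j, g j (if h : j ∈ S then v ⟨j, h⟩ else 0) = ∑ j : {j // j ∈ S}, g j.1 (v j) := by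
  rw [← Finset.sum_subset (Finset.subset_univ S) (fun j _ hj => by simp [hj, hg]),
    ← Finset.sum_coe_sort S]
  exact Finset.sum_congr rfl fun j _ => by simp

theorem l2_bound_primal
    (n p : ℕ) (X : Matrix (Fin n) (Fin p) ℝ) (y : Fin n → ℝ)
    (hy : ∀ i, y i = 0 ∨ y i = 1)
    (c_b : ℝ) (hcb : 0 < c_b) (hXb : ∀ i j, |X i j| ≤ c_b)
    (βs : Fin p → ℝ) (S : Finset (Fin p)) (hS : ∀ j, j ∈ S ↔ βs j ≠ 0)
    (s : ℕ) (hs : s = S.card)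
    (W : Matrix (Fin n) (Fin n) ℝ)
    (hW : W = Matrix.diagonal fun i => wFun (X i) βs)
    (XS : Matrix (Fin n) {j // j ∈ S} ℝ) (hXS : ∀ i j, XS i j = X i j.1)
    (cmin : ℝ) (hcmin : cmin = eigMin ((1 / (n : ℝ)) • (XSᵀ * W * XS)))
    (hA1 : 0 < cmin)
    (cmax : ℝ) (hcmax : cmax = eigMax ((1 / (n : ℝ)) • (Xᵀ * X)))
    (ε : Fin n → ℝ) (hε : ∀ i, ε i = y i - rho (X i) βs)
    (lam : ℝ) (hlam : 0 < lam)
    (hlamub : lam ≤ cmin ^ 2 / (10 * c_b * (s : ℝ) * cmax))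
    (hεb : linfNorm ((1 / (n : ℝ)) • (Xᵀ *ᵥ ε)) ≤ lam / 4)
    (αS : {j // j ∈ S} → ℝ)
    (hαS : ∀ θ : {j // j ∈ S} → ℝ,
      logLoss XS y αS + lam * l1norm αS ≤ logLoss XS y θ + lam * l1norm θ) :
    l2norm (fun j => αS j - βs j.1) ≤ 5 * lam * Real.sqrt s / cmin := by
  have hden : 0 < 10 * c_b * (s : ℝ) * cmax := by
    by_contra hneg
    exact absurd (hlam.trans_le hlamub)
      (not_lt.2 (div_nonpos_of_nonneg_of_nonpos (sq_nonneg _) (not_lt.1 hneg)))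
  have hs0 : (0 : ℝ) < s := by
    refine lt_of_le_of_ne (Nat.cast_nonneg _) fun h => ?_
    simp [← h] at hden
  have hcmax0 : 0 < cmax := pos_of_mul_pos_right hden (by positivity)
  have hlam_mul : lam * (10 * c_b * s * cmax) ≤ cmin ^ 2 := (le_div_iff₀ hden).1 hlamub
  have hsqrt : 0 < Real.sqrt s := Real.sqrt_pos.2 hs0
  have hsqrt_sq : Real.sqrt s * Real.sqrt s = s := Real.mul_self_sqrt hs0.le
  set b : {j // j ∈ S} → ℝ := fun j => βs j.1 with hb
  have hXb_dot : ∀ i, X i ⬝ᵥ βs = XS i ⬝ᵥ b := fun i => by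
    simp only [dotProduct, hXS, hb]
    rw [Finset.sum_coe_sort S fun j => X i j * βs j]
    refine (Finset.sum_subset (Finset.subset_univ S) fun j _ hj => ?_).symm
    rw [not_not.1 (mt (hS j).2 hj), mul_zero]
  by_contra! hgt
  set r := 5 * lam * Real.sqrt s / cmin with hr
  have hr0 : 0 < r := by positivity
  have hr_mul : r * cmin = 5 * lam * Real.sqrt s := by rw [hr]; field_simp
  set u : {j // j ∈ S} → ℝ := fun j => αS j - βs j.1 with hu
  have hu0 : 0 < l2norm u := hr0.trans hgt
  set t := r / l2norm u with ht
  have ht0 : 0 ≤ t := by positivity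
  have ht1 : t ≤ 1 := (div_le_one hu0).2 hgt.le
  set v := t • u with hv
  have hv2 : l2norm v = r := by
    rw [hv, l2norm_smul ht0, ht, div_mul_cancel₀ _ hu0.ne']
  have hv0 : 0 < l2norm v := hv2 ▸ hr0
  have hcomb : b + v = (1 - t) • b + t • αS := by
    ext j
    simp only [hv, hu, hb, Pi.add_apply, Pi.smul_apply, smul_eq_mul]
    ring
  have hl1 : l1norm v ≤ Real.sqrt s * r := by
    have h := l1norm_le_sqrt_card_mul_l2norm v
    rwa [hv2, Fintype.card_coe, ← hs] at h
  -- convexity transfers minimality from `αS` to the point at distance `r` on the segment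
  have hupper : logLoss XS y (b + v) - logLoss XS y b ≤ lam * l1norm v := by
    have h₁ := (convexOn_logLoss XS y).2 (Set.mem_univ b) (Set.mem_univ αS)
      (sub_nonneg.2 ht1) ht0 (sub_add_cancel 1 t)
    have h₂ := mul_le_mul_of_nonneg_left (convexOn_l1norm.2 (Set.mem_univ b)
      (Set.mem_univ αS) (sub_nonneg.2 ht1) ht0 (sub_add_cancel 1 t)) hlam.le
    rw [← hcomb, smul_eq_mul, smul_eq_mul] at h₁ h₂
    have h₃ := mul_le_mul_of_nonneg_left (hαS b) ht0
    have h₄ := mul_le_mul_of_nonneg_left (l1norm_sub_le b v) hlam.le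
    linarith
  have hD : ∀ i, |XS i ⬝ᵥ v| ≤ c_b * (Real.sqrt s * r) := fun i =>
    (abs_dotProduct_le_mul_l1norm fun j => hXS i j ▸ hXb i j.1).trans
      (mul_le_mul_of_nonneg_left hl1 hcb.le)
  have hlower := logLoss_taylor_lower XS y b v hD
  have hgrad : (1 / (n : ℝ)) * ∑ i, (y i - rho (XS i) b) * (XS i ⬝ᵥ v)
      ≤ lam / 4 * l1norm v := by
    set g : {j // j ∈ S} → ℝ := fun j => ((1 / (n : ℝ)) • (Xᵀ *ᵥ ε)) j.1 with hg
    have heq : (1 / (n : ℝ)) * ∑ i, (y i - rho (XS i) b) * (XS i ⬝ᵥ v) = g ⬝ᵥ v := by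
      simp only [hg, dotProduct, mulVec, Pi.smul_apply, smul_eq_mul, Finset.mul_sum,
        Finset.sum_mul, transpose_apply]
      rw [Finset.sum_comm]
      refine Finset.sum_congr rfl fun j _ => Finset.sum_congr rfl fun i _ => ?_
      rw [hε i, rho, rho, hXb_dot i, hXS]
      ring
    rw [heq]
    exact (le_abs_self _).trans
      (abs_dotProduct_le_mul_l1norm fun j => (abs_le_linfNorm _ j.1).trans hεb)
  have hhess : cmin * r ^ 2 ≤ 1 / (n : ℝ) * ∑ i, wFun (XS i) b * (XS i ⬝ᵥ v) ^ 2 := by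
    have h := eigMin_mul_sq_le (hcmin ▸ hA1) hv0
    rw [← hcmin, hv2, hW, quadratic_form_weighted_gram] at h
    simpa only [wFun, hXb_dot] using h
  have hgram : 1 / (n : ℝ) * ∑ i, (XS i ⬝ᵥ v) ^ 2 ≤ cmax * r ^ 2 := by
    set z : Fin p → ℝ := fun j => if h : j ∈ S then v ⟨j, h⟩ else 0 with hz
    have hz2 : l2norm z = r := by
      rw [← hv2, l2norm, l2norm, hz, sum_extend_zero S v (fun _ a => a ^ 2) (by simp)]
    have hdot : ∀ i, X i ⬝ᵥ z = XS i ⬝ᵥ v := fun i => by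
      simp only [dotProduct, hXS]
      exact sum_extend_zero S v (fun j a => X i j * a) (by simp)
    have h := le_eigMax_mul_sq (hcmax ▸ hcmax0) (hz2 ▸ hr0 : 0 < l2norm z)
    rw [← hcmax, hz2, quadratic_form_gram] at h
    simpa only [hdot] using h
  have hrem : c_b * (Real.sqrt s * r) * cmax ≤ cmin / 2 := by
    have : c_b * (Real.sqrt s * r) * cmax * cmin ≤ cmin / 2 * cmin := by
      calc c_b * (Real.sqrt s * r) * cmax * cmin
          = c_b * Real.sqrt s * cmax * (r * cmin) := by ring
        _ = 5 * lam * c_b * cmax * (Real.sqrt s * Real.sqrt s) := by rw [hr_mul]; ring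
        _ ≤ cmin / 2 * cmin := by rw [hsqrt_sq]; linarith
    exact le_of_mul_le_mul_right this hA1
  have hcubic : c_b * (Real.sqrt s * r) / 6 * (1 / (n : ℝ) * ∑ i, (XS i ⬝ᵥ v) ^ 2)
      ≤ cmin * r ^ 2 / 12 := by
    have h₁ := mul_le_mul_of_nonneg_left hgram
      (by positivity : 0 ≤ c_b * (Real.sqrt s * r) / 6)
    have h₂ := mul_le_mul_of_nonneg_right hrem (sq_nonneg r)
    linarith
  have hl1' : lam * l1norm v ≤ cmin * r ^ 2 / 5 := by
    calc lam * l1norm v ≤ lam * (Real.sqrt s * r) := mul_le_mul_of_nonneg_left hl1 hlam.le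
      _ = (5 * lam * Real.sqrt s) * r / 5 := by ring
      _ = cmin * r ^ 2 / 5 := by rw [← hr_mul]; ring
  have hpos : 0 < cmin * r ^ 2 := by positivity
  linarith
end
end

section
/- For every column index j ∈ [p], the Taylor remainder vector r satisfies |xʲᵀr/n| ≤ c_b·c_max·‖α̂_S − β*_S‖₂², where xʲ is the j-th column of X. -/
open scoped BigOperators
open Matrix

noncomputable section

lemma rho_eq_sigmoid {ι : Type*} [Fintype ι] (u v : ι → ℝ) :
    rho u v = Real.sigmoid (u ⬝ᵥ v) := by
  have h := Real.exp_pos (u ⬝ᵥ v)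
  rw [rho, Real.sigmoid_def, Real.exp_neg]
  field_simp
  ring

lemma wFun_eq_sigmoid {ι : Type*} [Fintype ι] (u v : ι → ℝ) :
    wFun u v = Real.sigmoid (u ⬝ᵥ v) * (1 - Real.sigmoid (u ⬝ᵥ v)) := by
  have h := Real.exp_pos (u ⬝ᵥ v)
  rw [← rho_eq_sigmoid, wFun, rho]
  field_simp
  ring

lemma abs_sigmoid_sub_le (a b : ℝ) : |Real.sigmoid b - Real.sigmoid a| ≤ |b - a| := by
  have h := convex_univ.norm_image_sub_le_of_norm_hasDerivWithin_le (C := 1)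
    (fun x _ => (Real.hasDerivAt_sigmoid x).hasDerivWithinAt)
    (fun x _ => by
      have h0 := Real.sigmoid_pos x
      have h1 := Real.sigmoid_lt_one x
      rw [Real.norm_eq_abs, abs_le]
      constructor <;> nlinarith)
    (Set.mem_univ a) (Set.mem_univ b)
  simpa using h

/-- First-order Taylor remainder bound for the sigmoid function. -/
lemma abs_sigmoid_taylor_remainder_le (a b : ℝ) :
    |Real.sigmoid b - Real.sigmoid a - Real.sigmoid a * (1 - Real.sigmoid a) * (b - a)|
      ≤ (b - a) ^ 2 := by
  have h := (convex_uIcc a b).norm_image_sub_le_of_norm_hasDerivWithin_le (C := |b - a|)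
    (f := fun t => Real.sigmoid t - Real.sigmoid a * (1 - Real.sigmoid a) * t)
    (fun x _ => ((Real.hasDerivAt_sigmoid x).sub
      ((hasDerivAt_id x).const_mul (Real.sigmoid a * (1 - Real.sigmoid a)))).hasDerivWithinAt)
    (fun x hx => by
      have hsub : |x - a| ≤ |b - a| := Set.abs_sub_left_of_mem_uIcc hx
      have h0 := Real.sigmoid_pos x
      have h1 := Real.sigmoid_lt_one x
      have h2 := Real.sigmoid_pos a
      have h3 := Real.sigmoid_lt_one a
      have hfac : |1 - Real.sigmoid x - Real.sigmoid a| ≤ 1 := by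
        rw [abs_le]; constructor <;> linarith
      calc ‖Real.sigmoid x * (1 - Real.sigmoid x)
              - Real.sigmoid a * (1 - Real.sigmoid a) * 1‖
          = |Real.sigmoid x - Real.sigmoid a| * |1 - Real.sigmoid x - Real.sigmoid a| := by
            rw [Real.norm_eq_abs, ← abs_mul]; congr 1; ring
        _ ≤ |Real.sigmoid x - Real.sigmoid a| :=
            mul_le_of_le_one_right (abs_nonneg _) hfac
        _ ≤ |b - a| := (abs_sigmoid_sub_le a x).trans hsub)
    Set.left_mem_uIcc Set.right_mem_uIcc
  rw [Real.norm_eq_abs, Real.norm_eq_abs, abs_mul_abs_self] at h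
  convert h using 2 <;> ring

lemma l2norm_sq {ι : Type*} [Fintype ι] (v : ι → ℝ) : l2norm v ^ 2 = ∑ j, v j ^ 2 :=
  Real.sq_sqrt (Finset.sum_nonneg fun _ _ => sq_nonneg _)

lemma l2norm_nonneg {ι : Type*} [Fintype ι] (v : ι → ℝ) : 0 ≤ l2norm v :=
  Real.sqrt_nonneg _

lemma bddAbove_rayleigh {ι : Type*} [Fintype ι] (M : Matrix ι ι ℝ) :
    BddAbove {c : ℝ | ∃ v : ι → ℝ, l2norm v = 1 ∧ c = v ⬝ᵥ (M *ᵥ v)} := by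
  refine ⟨∑ i, ∑ j, |M i j|, ?_⟩
  rintro c ⟨v, hv, rfl⟩
  have hle (i : ι) : |v i| ≤ 1 := by
    have hsum := l2norm_sq v
    have hi := Finset.single_le_sum (f := fun j => v j ^ 2) (fun j _ => sq_nonneg (v j))
      (Finset.mem_univ i)
    rw [← sq_le_one_iff_abs_le_one]
    rw [hv] at hsum
    linarith
  simp only [dotProduct, mulVec, Finset.mul_sum]
  refine Finset.sum_le_sum fun i _ => Finset.sum_le_sum fun j _ => ?_
  refine (le_abs_self _).trans ?_
  rw [abs_mul, abs_mul]
  calc |v i| * (|M i j| * |v j|) ≤ 1 * (|M i j| * 1) := by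
        gcongr
        exacts [hle i, hle j]
    _ = |M i j| := by ring

/-- The quadratic form of a matrix is bounded by its largest Rayleigh quotient. -/
lemma dotProduct_mulVec_le_eigMax {ι : Type*} [Fintype ι] (M : Matrix ι ι ℝ) (v : ι → ℝ) :
    v ⬝ᵥ (M *ᵥ v) ≤ eigMax M * l2norm v ^ 2 := by
  rcases (l2norm_nonneg v).eq_or_lt with h | h
  · have hz : v = 0 := by
      have hsum := l2norm_sq v
      rw [← h, zero_pow two_ne_zero, eq_comm,
        Finset.sum_eq_zero_iff_of_nonneg fun _ _ => sq_nonneg _] at hsum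
      funext i
      simpa using hsum i (Finset.mem_univ i)
    rw [← h, hz]
    simp
  · have hunit : l2norm ((l2norm v)⁻¹ • v) = 1 := by
      rw [← sq_eq_sq₀ (l2norm_nonneg _) zero_le_one, l2norm_sq]
      simp only [Pi.smul_apply, smul_eq_mul, mul_pow]
      rw [← Finset.mul_sum, ← l2norm_sq]
      field_simp
    have hle := le_csSup (bddAbove_rayleigh M) ⟨_, hunit, rfl⟩
    rw [mulVec_smul, smul_dotProduct, dotProduct_smul, smul_eq_mul, smul_eq_mul] at hle
    calc v ⬝ᵥ (M *ᵥ v)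
        = (l2norm v)⁻¹ * ((l2norm v)⁻¹ * (v ⬝ᵥ (M *ᵥ v))) * l2norm v ^ 2 := by field_simp
      _ ≤ eigMax M * l2norm v ^ 2 := by
        gcongr
        exact hle

lemma dotProduct_gram_mulVec {n : ℕ} {ι : Type*} [Fintype ι] (X : Matrix (Fin n) ι ℝ)
    (c : ℝ) (v : ι → ℝ) :
    v ⬝ᵥ ((c • (Xᵀ * X)) *ᵥ v) = c * ∑ i, (X i ⬝ᵥ v) ^ 2 := by
  rw [smul_mulVec, dotProduct_smul, ← mulVec_mulVec, dotProduct_mulVec, vecMul_transpose,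
    smul_eq_mul]
  simp only [dotProduct, mulVec, sq]

theorem remainder_column_bound
    (n p : ℕ) (X : Matrix (Fin n) (Fin p) ℝ) (y : Fin n → ℝ)
    (hy : ∀ i, y i = 0 ∨ y i = 1)
    (c_b : ℝ) (hcb : 0 < c_b) (hXb : ∀ i j, |X i j| ≤ c_b)
    (βs : Fin p → ℝ) (S : Finset (Fin p)) (hS : ∀ j, j ∈ S ↔ βs j ≠ 0)
    (s : ℕ) (hs : s = S.card)
    (W : Matrix (Fin n) (Fin n) ℝ)
    (hW : W = Matrix.diagonal fun i => wFun (X i) βs)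
    (XS : Matrix (Fin n) {j // j ∈ S} ℝ) (hXS : ∀ i j, XS i j = X i j.1)
    (cmax : ℝ) (hcmax : cmax = eigMax ((1 / (n : ℝ)) • (Xᵀ * X)))
    (lam : ℝ) (hlam : 0 < lam)
    (αS : {j // j ∈ S} → ℝ)
    (hαS : ∀ θ : {j // j ∈ S} → ℝ,
      logLoss XS y αS + lam * l1norm αS ≤ logLoss XS y θ + lam * l1norm θ)
    (r : Fin n → ℝ)
    (hr : ∀ i, r i = rho (XS i) αS - rho (XS i) (fun j => βs j.1)
      - wFun (XS i) (fun j => βs j.1) * (XS i ⬝ᵥ (fun j => αS j - βs j.1))) :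
    ∀ j : Fin p, |(∑ i, X i j * r i) / (n : ℝ)|
      ≤ c_b * cmax * (l2norm (fun k => αS k - βs k.1)) ^ 2 := by
  intro j
  set d : {j // j ∈ S} → ℝ := fun k => αS k - βs k.1
  let v : Fin p → ℝ := fun k => if h : k ∈ S then d ⟨k, h⟩ else 0
  have hvS (k : {j // j ∈ S}) : v k.1 = d k := by simp [v]
  have hsum (f : Fin p → ℝ) (hf : ∀ k ∉ S, f k = 0) :
      ∑ k, f k = ∑ k : {j // j ∈ S}, f k.1 := by
    rw [Finset.sum_coe_sort S f]
    exact (Finset.sum_subset (Finset.subset_univ S) fun k _ hk => hf k hk).symm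
  have hXv (i : Fin n) : X i ⬝ᵥ v = XS i ⬝ᵥ d := by
    simp only [dotProduct]
    rw [hsum _ fun k hk => by simp [v, hk]]
    simp only [hvS, hXS]
  have hnorm : l2norm v ^ 2 = l2norm d ^ 2 := by
    rw [l2norm_sq, l2norm_sq, hsum _ fun k hk => by simp [v, hk]]
    simp only [hvS]
  have hquad : (1 / (n : ℝ)) * ∑ i, (XS i ⬝ᵥ d) ^ 2 ≤ cmax * l2norm d ^ 2 := by
    have h := dotProduct_mulVec_le_eigMax ((1 / (n : ℝ)) • (Xᵀ * X)) v
    rw [dotProduct_gram_mulVec, hnorm, ← hcmax] at h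
    simpa only [hXv] using h
  have hri (i : Fin n) : |r i| ≤ (XS i ⬝ᵥ d) ^ 2 := by
    have hdot : XS i ⬝ᵥ d = XS i ⬝ᵥ αS - XS i ⬝ᵥ (fun j => βs j.1) :=
      dotProduct_sub _ _ _
    rw [hr, rho_eq_sigmoid, rho_eq_sigmoid, wFun_eq_sigmoid, hdot]
    exact abs_sigmoid_taylor_remainder_le _ _
  calc |(∑ i, X i j * r i) / (n : ℝ)| = |∑ i, X i j * r i| / n := by
        rw [abs_div, Nat.abs_cast]
    _ ≤ (∑ i, c_b * (XS i ⬝ᵥ d) ^ 2) / n := by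
        gcongr
        refine (Finset.abs_sum_le_sum_abs _ _).trans (Finset.sum_le_sum fun i _ => ?_)
        rw [abs_mul]
        exact mul_le_mul (hXb i j) (hri i) (abs_nonneg _) hcb.le
    _ = c_b * ((1 / (n : ℝ)) * ∑ i, (XS i ⬝ᵥ d) ^ 2) := by
        rw [← Finset.mul_sum]; ring
    _ ≤ c_b * (cmax * l2norm d ^ 2) := mul_le_mul_of_nonneg_left hquad hcb.le
    _ = c_b * cmax * l2norm d ^ 2 := by ring
end
end

section
/- (Lemma A3(ii)) If the dual vector satisfies ‖ν̂_{S^c}‖_∞ < 1, then every minimizer β̂ over ℝ^p of L(β) + λ‖β‖₁ satisfies supp(β̂) ⊆ S. -/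
open scoped BigOperators
open Matrix

noncomputable section

/-- Tangent-line inequality for the convex function `t ↦ log (1 + exp t)`. -/
lemma log_one_add_exp_tangent_le (a b : ℝ) :
    Real.log (1 + Real.exp a) + Real.exp a / (1 + Real.exp a) * (b - a)
      ≤ Real.log (1 + Real.exp b) := by
  have hconv := convexOn_exp.2 (Set.mem_univ (0 : ℝ)) (Set.mem_univ (b - a))
    (by positivity : 0 ≤ 1 / (1 + Real.exp a))
    (by positivity : 0 ≤ Real.exp a / (1 + Real.exp a)) (by field_simp)
  simp only [smul_eq_mul, mul_zero, zero_add, Real.exp_zero, mul_one] at hconv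
  rw [Real.le_log_iff_exp_le (by positivity), Real.exp_add, Real.exp_log (by positivity)]
  calc (1 + Real.exp a) * Real.exp (Real.exp a / (1 + Real.exp a) * (b - a))
      ≤ (1 + Real.exp a)
        * (1 / (1 + Real.exp a) + Real.exp a / (1 + Real.exp a) * Real.exp (b - a)) := by
        gcongr
    _ = 1 + Real.exp b := by
        rw [Real.exp_sub]
        field_simp

/-- The gradient of the logistic loss. -/
def logLossGrad {n : ℕ} {ι : Type*} [Fintype ι] (X : Matrix (Fin n) ι ℝ)
    (y : Fin n → ℝ) (β : ι → ℝ) (j : ι) : ℝ :=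
  (1 / (n : ℝ)) * ∑ i, X i j * (rho (X i) β - y i)

lemma logLossGrad_dotProduct {n : ℕ} {ι : Type*} [Fintype ι] (X : Matrix (Fin n) ι ℝ)
    (y : Fin n → ℝ) (β d : ι → ℝ) :
    logLossGrad X y β ⬝ᵥ d = (1 / (n : ℝ)) * ∑ i, (rho (X i) β - y i) * (X i ⬝ᵥ d) := by
  simp only [logLossGrad, dotProduct, Finset.mul_sum, Finset.sum_mul]
  rw [Finset.sum_comm]
  refine Finset.sum_congr rfl fun i _ => Finset.sum_congr rfl fun j _ => ?_
  ring

/-- First-order convexity inequality for the logistic loss. -/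
lemma logLoss_add_grad_le {n : ℕ} {ι : Type*} [Fintype ι] (X : Matrix (Fin n) ι ℝ)
    (y : Fin n → ℝ) (β γ : ι → ℝ) :
    logLoss X y β + logLossGrad X y β ⬝ᵥ (γ - β) ≤ logLoss X y γ := by
  rw [logLossGrad_dotProduct, logLoss, logLoss, ← mul_add, ← Finset.sum_add_distrib]
  gcongr with i
  have h := log_one_add_exp_tangent_le (X i ⬝ᵥ β) (X i ⬝ᵥ γ)
  rw [dotProduct_sub, rho]
  linarith

lemma continuous_logLossGrad_dotProduct {n : ℕ} {ι : Type*} [Fintype ι]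
    (X : Matrix (Fin n) ι ℝ) (y : Fin n → ℝ) (d : ι → ℝ) :
    Continuous fun β => logLossGrad X y β ⬝ᵥ d := by
  simp only [dotProduct, logLossGrad, rho]
  have h : ∀ t : ℝ, 1 + Real.exp t ≠ 0 := fun t => by positivity
  fun_prop (disch := intros; apply h)

/-- First-order optimality condition for an `ℓ1`-penalized logistic loss minimizer. -/
lemma neg_logLossGrad_dotProduct_le_of_minimizer {n : ℕ} {ι : Type*} [Fintype ι]
    (X : Matrix (Fin n) ι ℝ) (y : Fin n → ℝ) {lam : ℝ} (hlam : 0 ≤ lam) {α : ι → ℝ}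
    (hα : ∀ θ, logLoss X y α + lam * l1norm α ≤ logLoss X y θ + lam * l1norm θ)
    (θ : ι → ℝ) :
    -(logLossGrad X y α ⬝ᵥ (θ - α)) ≤ lam * (l1norm θ - l1norm α) := by
  have hcont : Continuous fun t : ℝ => -(logLossGrad X y (α + t • (θ - α)) ⬝ᵥ (θ - α)) :=
    ((continuous_logLossGrad_dotProduct X y (θ - α)).comp
      (by fun_prop : Continuous fun t : ℝ => α + t • (θ - α))).neg
  have hlim := (hcont.tendsto 0).mono_left (nhdsWithin_le_nhds (s := Set.Ioi 0))
  simp only [zero_smul, add_zero] at hlim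
  refine le_of_tendsto hlim ?_
  filter_upwards [Ioo_mem_nhdsGT (zero_lt_one' ℝ)] with t ht
  have hgrad := logLoss_add_grad_le X y (α + t • (θ - α)) α
  rw [sub_add_cancel_left, ← smul_neg, dotProduct_smul, dotProduct_neg, smul_eq_mul] at hgrad
  have hnorm : l1norm (α + t • (θ - α)) ≤ l1norm α + t * (l1norm θ - l1norm α) := by
    simp only [l1norm, ← Finset.sum_sub_distrib, Finset.mul_sum, ← Finset.sum_add_distrib]
    refine Finset.sum_le_sum fun j _ => ?_
    have h : (α + t • (θ - α)) j = (1 - t) * α j + t * θ j := by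
      simp only [Pi.add_apply, Pi.smul_apply, Pi.sub_apply, smul_eq_mul]
      ring
    rw [h]
    refine (abs_add_le _ _).trans_eq ?_
    rw [abs_mul, abs_mul, abs_of_pos ht.1, abs_of_pos (sub_pos.2 ht.2)]
    ring
  have hmin := hα (α + t • (θ - α))
  have hscaled := mul_le_mul_of_nonneg_left hnorm hlam
  refine le_of_mul_le_mul_left ?_ ht.1
  linarith

theorem dual_strict_support
    (n p : ℕ) (X : Matrix (Fin n) (Fin p) ℝ) (y : Fin n → ℝ)
    (hy : ∀ i, y i = 0 ∨ y i = 1)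
    (c_b : ℝ) (hcb : 0 < c_b) (hXb : ∀ i j, |X i j| ≤ c_b)
    (βs : Fin p → ℝ) (S : Finset (Fin p)) (hS : ∀ j, j ∈ S ↔ βs j ≠ 0)
    (s : ℕ) (hs : s = S.card)
    (W : Matrix (Fin n) (Fin n) ℝ)
    (hW : W = Matrix.diagonal fun i => wFun (X i) βs)
    (XS : Matrix (Fin n) {j // j ∈ S} ℝ) (hXS : ∀ i j, XS i j = X i j.1)
    (lam : ℝ) (hlam : 0 < lam)
    (αS : {j // j ∈ S} → ℝ)
    (hαS : ∀ θ : {j // j ∈ S} → ℝ,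
      logLoss XS y αS + lam * l1norm αS ≤ logLoss XS y θ + lam * l1norm θ)
    (αhat : Fin p → ℝ)
    (hαhat : ∀ j : Fin p, αhat j = if h : j ∈ S then αS ⟨j, h⟩ else 0)
    (ν : Fin p → ℝ)
    (hν : ∀ j, ν j = (1 / ((n : ℝ) * lam)) * ∑ i, X i j * (y i - rho (X i) αhat))
    (hdual : linfNorm (fun j : {j // j ∉ S} => ν j.1) < 1) :
    ∀ βh : Fin p → ℝ,
      (∀ β : Fin p → ℝ,
        logLoss X y βh + lam * l1norm βh ≤ logLoss X y β + lam * l1norm β) →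
      ∀ j : Fin p, βh j ≠ 0 → j ∈ S := by
  intro βh hβh j hj
  by_contra hjS
  have hdot : ∀ i, XS i ⬝ᵥ αS = X i ⬝ᵥ αhat := fun i => by
    simp only [dotProduct]
    rw [← Finset.sum_subset (Finset.subset_univ S)
      (fun k _ hk => by rw [hαhat, dif_neg hk, mul_zero]), ← Finset.sum_coe_sort S]
    exact Finset.sum_congr rfl fun k _ => by rw [hXS, hαhat, dif_pos k.2]
  have hgrad : ∀ k, logLossGrad X y αhat k = -(lam * ν k) := fun k => by
    have hneg : ∑ i, X i k * (rho (X i) αhat - y i) = -∑ i, X i k * (y i - rho (X i) αhat) := by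
      rw [← Finset.sum_neg_distrib]
      exact Finset.sum_congr rfl fun i _ => by ring
    rw [logLossGrad, hν, hneg, one_div, one_div, mul_inv]
    field_simp
  have hgradS : ∀ k, logLossGrad XS y αS k = -(lam * ν k.1) := fun k => by
    rw [← hgrad]
    simp only [logLossGrad, rho, hdot, hXS]
  have hν_lt : ∀ k, k ∉ S → |ν k| < 1 := fun k hk =>
    (le_ciSup (f := fun j : {j // j ∉ S} => |ν j.1|)
      (Set.finite_range _).bddAbove ⟨k, hk⟩).trans_lt hdual
  have hopt := neg_logLossGrad_dotProduct_le_of_minimizer XS y hlam.le hαS fun k => βh k.1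
  have hconv := logLoss_add_grad_le X y αhat βh
  have hmin := hβh αhat
  have hon : 0 ≤ ∑ k ∈ S, lam * (|βh k| - |αhat k| - ν k * (βh k - αhat k)) := by
    rw [← Finset.sum_coe_sort S]
    simp only [l1norm, dotProduct, hgradS, Pi.sub_apply, ← Finset.sum_sub_distrib,
      ← Finset.sum_neg_distrib, Finset.mul_sum] at hopt
    rw [← sub_nonneg, ← Finset.sum_sub_distrib] at hopt
    refine hopt.trans_eq (Finset.sum_congr rfl fun k _ => ?_)
    rw [hαhat, dif_pos k.2]
    ring
  have hoff : 0 < ∑ k ∈ Sᶜ, lam * (|βh k| - |αhat k| - ν k * (βh k - αhat k)) := by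
    have hterm : ∀ k ∈ Sᶜ, lam * (|βh k| - |αhat k| - ν k * (βh k - αhat k))
        = lam * (|βh k| - ν k * βh k) := fun k hk => by
      rw [hαhat, dif_neg (Finset.mem_compl.1 hk), abs_zero, sub_zero, sub_zero]
    have hle : ∀ k, ν k * βh k ≤ |ν k| * |βh k| := fun k =>
      (le_abs_self _).trans_eq (abs_mul _ _)
    rw [Finset.sum_congr rfl hterm]
    refine Finset.sum_pos' (fun k hk => mul_nonneg hlam.le ?_)
      ⟨j, Finset.mem_compl.2 hjS, mul_pos hlam ?_⟩
    · nlinarith [hle k, hν_lt k (Finset.mem_compl.1 hk), abs_nonneg (βh k)]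
    · nlinarith [hle j, hν_lt j hjS, abs_pos.2 hj]
  have hsum : lam * l1norm βh - lam * l1norm αhat + logLossGrad X y αhat ⬝ᵥ (βh - αhat)
      = ∑ k, lam * (|βh k| - |αhat k| - ν k * (βh k - αhat k)) := by
    simp only [l1norm, dotProduct, hgrad, Pi.sub_apply, Finset.mul_sum,
      ← Finset.sum_sub_distrib, ← Finset.sum_add_distrib]
    exact Finset.sum_congr rfl fun k _ => by ring
  rw [← Finset.sum_add_sum_compl S] at hsum
  linarith
end
end
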